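/- Let S be a nonempty finite set of positive integers with m = max S and m ≥ 3. Then for every n ≥ m, cp_n(S) = 2^{n−m}·cp_m(S). -/

import Mathlib

/-- The permutation σ of `Fin n` viewed as a word on `[n] = {1,…,n}`:
position `j` (0-indexed) carries the letter `σ(j)+1`; out-of-range positions give `0`. -/
def permToFun (n : ℕ) (σ : Equiv.Perm (Fin n)) : ℕ → ℕ :=
  fun j => if h : j < n then ((σ ⟨j, h⟩ : ℕ) + 1) else 0

/-- The circular peak set `CP(σ) = {σ(i) | σ(i-1) < σ(i) > σ(i+1)}` of a
permutation of `[n]`, as a `Finset ℕ` of values in `{1,…,n}`. -/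
def circularPeakSet (n : ℕ) (σ : Equiv.Perm (Fin n)) : Finset ℕ :=
  ((Finset.Ioo 0 (n - 1)).filter (fun j =>
    permToFun n σ (j - 1) < permToFun n σ j ∧
    permToFun n σ (j + 1) < permToFun n σ j)).image (permToFun n σ)

/-- `CPperms n S` is the set `CP_n(S)` of permutations of `[n]` with circular peak set `S`. -/
def CPperms (n : ℕ) (S : Finset ℕ) : Finset (Equiv.Perm (Fin n)) :=
  Finset.univ.filter (fun σ => circularPeakSet n σ = S)

/-- `cp n S = |CP_n(S)|`. -/
def cp (n : ℕ) (S : Finset ℕ) : ℕ := (CPperms n S).card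


lemma mem_cps (n : ℕ) (σ : Equiv.Perm (Fin n)) (x : ℕ) :
    x ∈ circularPeakSet n σ ↔ ∃ j, 0 < j ∧ j + 1 < n ∧
      permToFun n σ (j - 1) < permToFun n σ j ∧
      permToFun n σ (j + 1) < permToFun n σ j ∧ permToFun n σ j = x := by
  simp only [circularPeakSet, Finset.mem_image, Finset.mem_filter, Finset.mem_Ioo]
  constructor
  · rintro ⟨j, ⟨⟨h1, h2⟩, h3, h4⟩, h5⟩
    exact ⟨j, h1, by omega, h3, h4, h5⟩
  · rintro ⟨j, h1, h2, h3, h4, h5⟩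
    exact ⟨j, ⟨⟨h1, by omega⟩, h3, h4⟩, h5⟩

lemma ptf_le (n : ℕ) (σ : Equiv.Perm (Fin n)) (j : ℕ) : permToFun n σ j ≤ n := by
  unfold permToFun
  split_ifs with h
  · exact (σ ⟨j, h⟩).isLt
  · omega

def appL (n : ℕ) (τ : Equiv.Perm (Fin n)) : Equiv.Perm (Fin (n + 1)) :=
  finSuccEquivLast.trans ((Equiv.optionCongr τ).trans finSuccEquivLast.symm)

def appF (n : ℕ) (τ : Equiv.Perm (Fin n)) : Equiv.Perm (Fin (n + 1)) :=
  (finRotate (n + 1)).symm.trans (appL n τ)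

lemma appL_last (n : ℕ) (τ : Equiv.Perm (Fin n)) : appL n τ (Fin.last n) = Fin.last n := by
  simp [appL]

lemma appL_castSucc (n : ℕ) (τ : Equiv.Perm (Fin n)) (i : Fin n) :
    appL n τ i.castSucc = (τ i).castSucc := by
  simp [appL]

lemma rot_zero (n : ℕ) : (finRotate (n + 1)).symm 0 = Fin.last n := by
  rw [Equiv.symm_apply_eq]; simp

lemma rot_succ (n : ℕ) (i : Fin n) : (finRotate (n + 1)).symm i.succ = i.castSucc := by
  rw [Equiv.symm_apply_eq]; simp

lemma appF_zero (n : ℕ) (τ : Equiv.Perm (Fin n)) : appF n τ 0 = Fin.last n := by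
  simp only [appF, Equiv.trans_apply, rot_zero, appL_last]

lemma appF_succ (n : ℕ) (τ : Equiv.Perm (Fin n)) (i : Fin n) :
    appF n τ i.succ = (τ i).castSucc := by
  simp only [appF, Equiv.trans_apply, rot_succ, appL_castSucc]

lemma appL_inj (n : ℕ) : Function.Injective (appL n) := by
  intro a b h
  ext i
  have := congrArg (fun f => ((f i.castSucc : Fin (n + 1)) : ℕ)) h
  simpa [appL_castSucc] using this

lemma appF_inj (n : ℕ) : Function.Injective (appF n) := by
  intro a b h
  ext i
  have := congrArg (fun f => ((f i.succ : Fin (n + 1)) : ℕ)) h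
  simpa [appF_succ] using this

lemma appL_surj (n : ℕ) (σ : Equiv.Perm (Fin (n + 1))) (h : σ (Fin.last n) = Fin.last n) :
    ∃ τ, appL n τ = σ := by
  have hne : ∀ i : Fin n, σ i.castSucc ≠ Fin.last n := by
    intro i hi
    rw [← h] at hi
    exact (Fin.castSucc_lt_last i).ne (σ.injective hi)
  let f : Fin n → Fin n := fun i => (σ i.castSucc).castPred (hne i)
  have hf : Function.Injective f := by
    intro a b hab
    have h2 : σ a.castSucc = σ b.castSucc := by
      have := congrArg Fin.castSucc hab
      simpa [f] using this
    exact Fin.castSucc_injective n (σ.injective h2)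
  refine ⟨Equiv.ofBijective f (Finite.injective_iff_bijective.mp hf), ?_⟩
  apply Equiv.ext
  intro i
  refine Fin.lastCases ?_ (fun i => ?_) i
  · rw [appL_last, h]
  · rw [appL_castSucc]; simp [f]

lemma appF_surj (n : ℕ) (σ : Equiv.Perm (Fin (n + 1))) (h : σ 0 = Fin.last n) :
    ∃ τ, appF n τ = σ := by
  obtain ⟨τ, hτ⟩ := appL_surj n ((finRotate (n + 1)).trans σ) (by simp [h])
  refine ⟨τ, ?_⟩
  rw [appF, hτ]
  apply Equiv.ext
  intro i
  simp only [Equiv.trans_apply, Equiv.apply_symm_apply]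

lemma ptf_appL_lt (n : ℕ) (τ : Equiv.Perm (Fin n)) (j : ℕ) (h : j < n) :
    permToFun (n + 1) (appL n τ) j = permToFun n τ j := by
  have := appL_castSucc n τ ⟨j, h⟩
  simp only [Fin.castSucc_mk] at this
  simp [permToFun, h, Nat.lt_succ_of_lt h, this]

lemma ptf_appL_n (n : ℕ) (τ : Equiv.Perm (Fin n)) :
    permToFun (n + 1) (appL n τ) n = n + 1 := by
  have := appL_last n τ
  simp only [Fin.last] at this
  simp [permToFun, this]

lemma ptf_appF_succ (n : ℕ) (τ : Equiv.Perm (Fin n)) (j : ℕ) :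
    permToFun (n + 1) (appF n τ) (j + 1) = permToFun n τ j := by
  by_cases h : j < n
  · have := appF_succ n τ ⟨j, h⟩
    simp only [Fin.succ_mk] at this
    simp [permToFun, h, this]
  · simp [permToFun, h]

lemma ptf_appF_zero (n : ℕ) (τ : Equiv.Perm (Fin n)) :
    permToFun (n + 1) (appF n τ) 0 = n + 1 := by
  have := appF_zero n τ
  simp [permToFun, this]

lemma cps_appL (n : ℕ) (τ : Equiv.Perm (Fin n)) :
    circularPeakSet (n + 1) (appL n τ) = circularPeakSet n τ := by
  ext x
  rw [mem_cps, mem_cps]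
  constructor
  · rintro ⟨j, h1, h2, h3, h4, h5⟩
    rw [ptf_appL_lt n τ j (by omega)] at h3 h4 h5
    rw [ptf_appL_lt n τ (j - 1) (by omega)] at h3
    have hj : j + 1 < n := by
      by_contra hc
      have : j + 1 = n := by omega
      rw [this, ptf_appL_n] at h4
      have := ptf_le n τ j
      omega
    rw [ptf_appL_lt n τ (j + 1) hj] at h4
    exact ⟨j, h1, hj, h3, h4, h5⟩
  · rintro ⟨j, h1, h2, h3, h4, h5⟩
    refine ⟨j, h1, by omega, ?_⟩
    rw [ptf_appL_lt n τ j (by omega), ptf_appL_lt n τ (j - 1) (by omega),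
      ptf_appL_lt n τ (j + 1) h2]
    exact ⟨h3, h4, h5⟩

lemma cps_appF (n : ℕ) (τ : Equiv.Perm (Fin n)) :
    circularPeakSet (n + 1) (appF n τ) = circularPeakSet n τ := by
  ext x
  rw [mem_cps, mem_cps]
  constructor
  · rintro ⟨j, h1, h2, h3, h4, h5⟩
    obtain ⟨k, rfl⟩ : ∃ k, j = k + 1 := ⟨j - 1, by omega⟩
    simp only [Nat.add_sub_cancel] at h3
    rw [ptf_appF_succ] at h3 h4 h5
    rw [ptf_appF_succ] at h4
    rcases k with _ | k
    · rw [ptf_appF_zero] at h3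
      have := ptf_le n τ 0
      omega
    · rw [ptf_appF_succ] at h3
      exact ⟨k + 1, by omega, by omega, by simpa using h3, h4, h5⟩
  · rintro ⟨j, h1, h2, h3, h4, h5⟩
    obtain ⟨k, rfl⟩ : ∃ k, j = k + 1 := ⟨j - 1, by omega⟩
    refine ⟨k + 1 + 1, by omega, by omega, ?_⟩
    simp only [Nat.add_sub_cancel] at h3 ⊢
    simp only [ptf_appF_succ]
    exact ⟨h3, h4, h5⟩

lemma end_of_not_mem (n : ℕ) (σ : Equiv.Perm (Fin (n + 1)))
    (h : n + 1 ∉ circularPeakSet (n + 1) σ) :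
    σ (Fin.last n) = Fin.last n ∨ σ 0 = Fin.last n := by
  obtain ⟨⟨j, hj⟩, hσ⟩ := σ.surjective (Fin.last n)
  by_cases h0 : j = 0
  · subst h0; right; exact hσ
  by_cases hn : j = n
  · subst hn; left; exact hσ
  exfalso
  apply h
  have hlt : ∀ k, k ≠ j → permToFun (n + 1) σ k < n + 1 := by
    intro k hk
    unfold permToFun
    split_ifs with hk2
    · have h1 : σ ⟨k, hk2⟩ ≠ Fin.last n := by
        rw [← hσ]
        intro he
        have := σ.injective he
        simp at this
        exact hk this
      have := Fin.lt_last_iff_ne_last.mpr h1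
      have : (σ ⟨k, hk2⟩ : ℕ) < n := this
      omega
    · omega
  have hv : permToFun (n + 1) σ j = n + 1 := by simp [permToFun, hj, hσ]
  rw [mem_cps]
  refine ⟨j, by omega, by omega, ?_, ?_, hv⟩
  · rw [hv]; exact hlt _ (by omega)
  · rw [hv]; exact hlt _ (by omega)

lemma cp_succ (n : ℕ) (hn : 1 ≤ n) (S : Finset ℕ) (h : n + 1 ∉ S) :
    cp (n + 1) S = 2 * cp n S := by
  have key : CPperms (n + 1) S =
      (CPperms n S).image (appL n) ∪ (CPperms n S).image (appF n) := by
    ext σ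
    simp only [CPperms, Finset.mem_union, Finset.mem_image, Finset.mem_filter,
      Finset.mem_univ, true_and]
    constructor
    · intro hs
      rcases end_of_not_mem n σ (by rw [hs]; exact h) with h1 | h1
      · obtain ⟨τ, rfl⟩ := appL_surj n σ h1
        exact Or.inl ⟨τ, by rw [← hs, cps_appL], rfl⟩
      · obtain ⟨τ, rfl⟩ := appF_surj n σ h1
        exact Or.inr ⟨τ, by rw [← hs, cps_appF], rfl⟩
    · rintro (⟨τ, h1, rfl⟩ | ⟨τ, h1, rfl⟩)
      · rw [cps_appL, h1]
      · rw [cps_appF, h1]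
  unfold cp
  rw [key, Finset.card_union_of_disjoint, Finset.card_image_of_injective _ (appL_inj n),
    Finset.card_image_of_injective _ (appF_inj n)]
  · ring
  · rw [Finset.disjoint_left]
    intro σ ha hb
    obtain ⟨a, -, rfl⟩ := Finset.mem_image.mp ha
    obtain ⟨b, -, hb⟩ := Finset.mem_image.mp hb
    have h1 := appF_zero n b
    rw [hb, ← appL_last n a] at h1
    have h2 := congrArg Fin.val ((appL n a).injective h1)
    simp at h2
    omega

/-- Lemma 2.1(2): if `S` is a nonempty finite set of positive integers with
`m = max S ≥ 3`, then for every `n ≥ m`, `cp_n(S) = 2^{n-m} · cp_m(S)`. -/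
theorem cp_eq_two_pow_mul_cp_max (S : Finset ℕ) (hSne : S.Nonempty)
    (hpos : ∀ x ∈ S, 0 < x) (m : ℕ) (hm : m = S.max' hSne) (hm3 : 3 ≤ m) :
    ∀ n, m ≤ n → cp n S = 2 ^ (n - m) * cp m S := by
  intro n hn
  induction n, hn using Nat.le_induction with
  | base => simp
  | succ n hn ih =>
    rw [cp_succ n (by omega) S, ih, Nat.succ_sub hn, pow_succ]
    · ring
    · intro hmem
      have := S.le_max' _ hmem
      omega
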